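/- (Convexity of the Bregman proximal average) Suppose, in addition to the standing assumptions, that the symmetrized Bregman distance S_φ is convex on U × U, that f₁, f₂ ∈ Γ₀(ℝⁿ), and that ri(dom f_i) ∩ U ≠ ∅ for i = 1,2 (ri denoting relative interior). Then for every λ > 0 and α ∈ [0,1], the Bregman proximal average P^φ_λ(f₁,f₂,α) is convex. -/

import Mathlib

open scoped RealInnerProductSpace Pointwise Topology Classical

noncomputable section

/-- Effective domain of an extended-real-valued function. -/
def edom {n : ℕ} (f : EuclideanSpace ℝ (Fin n) → EReal) : Set (EuclideanSpace ℝ (Fin n)) :=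
  {x | f x ≠ ⊤}

/-- Proper: nowhere `⊥` and not identically `⊤`. -/
def ProperFn {n : ℕ} (f : EuclideanSpace ℝ (Fin n) → EReal) : Prop :=
  (∀ x, f x ≠ ⊥) ∧ ∃ x, f x ≠ ⊤

/-- Convexity for extended-real-valued functions. -/
def ConvexFn {n : ℕ} (f : EuclideanSpace ℝ (Fin n) → EReal) : Prop :=
  ∀ x y : EuclideanSpace ℝ (Fin n), ∀ a b : ℝ, 0 ≤ a → 0 ≤ b → a + b = 1 →
    f (a • x + b • y) ≤ (a : EReal) * f x + (b : EReal) * f y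

/-- `Γ₀`: proper, lower semicontinuous, convex. -/
def Gamma0 {n : ℕ} (f : EuclideanSpace ℝ (Fin n) → EReal) : Prop :=
  ProperFn f ∧ LowerSemicontinuous f ∧ ConvexFn f

/-- Fenchel conjugate. -/
def fconj {n : ℕ} (f : EuclideanSpace ℝ (Fin n) → EReal) (y : EuclideanSpace ℝ (Fin n)) :
    EReal :=
  ⨆ x, ((⟪y, x⟫ : ℝ) : EReal) - f x

/-- Convex subdifferential. -/
def subdiff {n : ℕ} (f : EuclideanSpace ℝ (Fin n) → EReal) (x : EuclideanSpace ℝ (Fin n)) :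
    Set (EuclideanSpace ℝ (Fin n)) :=
  {u | ∀ y, f x + ((⟪u, y - x⟫ : ℝ) : EReal) ≤ f y}

/-- 1-coercive (supercoercive): `f x / ‖x‖ → ∞` as `‖x‖ → ∞`. -/
def SuperCoercive {n : ℕ} (f : EuclideanSpace ℝ (Fin n) → EReal) : Prop :=
  ∀ c : ℝ, ∃ R : ℝ, ∀ x, R ≤ ‖x‖ → ((c * ‖x‖ : ℝ) : EReal) ≤ f x

/-- Legendre-type function `φ` with gradient map `gφ` on `U = int (dom φ)`:
proper, lsc, convex, `U ≠ ∅`, differentiable on `U`, essentially smooth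
(gradient blows up along sequences approaching the boundary), and
essentially strictly convex (strictly convex on `U`). -/
structure IsLegendre {n : ℕ} (φ : EuclideanSpace ℝ (Fin n) → EReal)
    (gφ : EuclideanSpace ℝ (Fin n) → EuclideanSpace ℝ (Fin n)) : Prop where
  proper : ProperFn φ
  lsc : LowerSemicontinuous φ
  convex : ConvexFn φ
  intNonempty : (interior (edom φ)).Nonempty
  grad : ∀ x ∈ interior (edom φ), HasGradientAt (fun y => (φ y).toReal) (gφ x) x
  essSmooth : ∀ (u : ℕ → EuclideanSpace ℝ (Fin n)) (x : EuclideanSpace ℝ (Fin n)),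
      (∀ k, u k ∈ interior (edom φ)) → x ∈ frontier (edom φ) →
      Filter.Tendsto u Filter.atTop (nhds x) →
      Filter.Tendsto (fun k => ‖gφ (u k)‖) Filter.atTop Filter.atTop
  essStrictConvex : ∀ x ∈ interior (edom φ), ∀ y ∈ interior (edom φ), x ≠ y →
      ∀ a b : ℝ, 0 < a → 0 < b → a + b = 1 →
      φ (a • x + b • y) < (a : EReal) * φ x + (b : EReal) * φ y

/-- Bregman distance `D_φ`. -/
def bregman {n : ℕ} (φ : EuclideanSpace ℝ (Fin n) → EReal)
    (gφ : EuclideanSpace ℝ (Fin n) → EuclideanSpace ℝ (Fin n))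
    (x y : EuclideanSpace ℝ (Fin n)) : EReal :=
  if y ∈ interior (edom φ) then φ x - φ y - ((⟪gφ y, x - y⟫ : ℝ) : EReal) else ⊤

/-- Left Bregman envelope `env^φ_λ f`. -/
def benv {n : ℕ} (φ : EuclideanSpace ℝ (Fin n) → EReal)
    (gφ : EuclideanSpace ℝ (Fin n) → EuclideanSpace ℝ (Fin n)) (lam : ℝ)
    (f : EuclideanSpace ℝ (Fin n) → EReal) (y : EuclideanSpace ℝ (Fin n)) : EReal :=
  ⨅ x, f x + ((1 / lam : ℝ) : EReal) * bregman φ gφ x y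

/-- Left Bregman proximal map `prox^φ_λ f` (set of minimizers). -/
def bprox {n : ℕ} (φ : EuclideanSpace ℝ (Fin n) → EReal)
    (gφ : EuclideanSpace ℝ (Fin n) → EuclideanSpace ℝ (Fin n)) (lam : ℝ)
    (f : EuclideanSpace ℝ (Fin n) → EReal) (y : EuclideanSpace ℝ (Fin n)) :
    Set (EuclideanSpace ℝ (Fin n)) :=
  {x | f x + ((1 / lam : ℝ) : EReal) * bregman φ gφ x y ≠ ⊤ ∧
    ∀ z, f x + ((1 / lam : ℝ) : EReal) * bregman φ gφ x y ≤
      f z + ((1 / lam : ℝ) : EReal) * bregman φ gφ z y}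

/-- φ-prox-boundedness threshold `λ_f`. -/
def proxThreshold {n : ℕ} (φ : EuclideanSpace ℝ (Fin n) → EReal)
    (gφ : EuclideanSpace ℝ (Fin n) → EuclideanSpace ℝ (Fin n))
    (f : EuclideanSpace ℝ (Fin n) → EReal) : EReal :=
  sSup ((fun lam : ℝ => (lam : EReal)) ''
    {lam : ℝ | 0 < lam ∧ ∃ x, benv φ gφ lam f x ≠ ⊥})

/-- λ-φ-proximal hull: pointwise supremum of all minorants `c - (1/λ) D_φ(·, w)`. -/
def phull {n : ℕ} (φ : EuclideanSpace ℝ (Fin n) → EReal)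
    (gφ : EuclideanSpace ℝ (Fin n) → EuclideanSpace ℝ (Fin n)) (lam : ℝ)
    (f : EuclideanSpace ℝ (Fin n) → EReal) (x : EuclideanSpace ℝ (Fin n)) : EReal :=
  ⨆ (c : ℝ) (w : EuclideanSpace ℝ (Fin n)) (_ : w ∈ interior (edom φ))
    (_ : ∀ z, (c : EReal) - ((1 / lam : ℝ) : EReal) * bregman φ gφ z w ≤ f z),
    ((c : EReal) - ((1 / lam : ℝ) : EReal) * bregman φ gφ x w)

/-- Combettes–Reyes anisotropic envelope `f □ ψ`. -/
def aenv {n : ℕ} (ψ f : EuclideanSpace ℝ (Fin n) → EReal) (x : EuclideanSpace ℝ (Fin n)) :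
    EReal :=
  ⨅ y, f y + ψ (x - y)

/-- Combettes–Reyes anisotropic proximal map `aprox^ψ f`. -/
def aprox {n : ℕ} (ψ f : EuclideanSpace ℝ (Fin n) → EReal) (x : EuclideanSpace ℝ (Fin n)) :
    Set (EuclideanSpace ℝ (Fin n)) :=
  {y | f y + ψ (x - y) ≠ ⊤ ∧ ∀ z, f y + ψ (x - y) ≤ f z + ψ (x - z)}

/-- Subtraction with the conventions `⊤ - ⊤ = ⊤` and `⊤ - r = ⊤`. -/
def esub (a b : EReal) : EReal := if a = ⊤ then ⊤ else a - b

/-- Convex hull of a function: the largest convex minorant. -/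
def convFn {n : ℕ} (f : EuclideanSpace ℝ (Fin n) → EReal) (x : EuclideanSpace ℝ (Fin n)) :
    EReal :=
  ⨆ (g : EuclideanSpace ℝ (Fin n) → EReal) (_ : ConvexFn g ∧ ∀ y, g y ≤ f y), g x

/-- Epi-multiplication `μ ⋆ g`. -/
def epiMul {n : ℕ} (μ : ℝ) (g : EuclideanSpace ℝ (Fin n) → EReal)
    (x : EuclideanSpace ℝ (Fin n)) : EReal :=
  if 0 < μ then (μ : EReal) * g ((1 / μ) • x) else (if x = 0 then 0 else ⊤)

/-- Infimal convolution. -/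
def infConv {n : ℕ} (g h : EuclideanSpace ℝ (Fin n) → EReal)
    (x : EuclideanSpace ℝ (Fin n)) : EReal :=
  ⨅ u, g u + h (x - u)

/-- The α-weighted Bregman proximal average with parameter λ. -/
def pavg {n : ℕ} (φ : EuclideanSpace ℝ (Fin n) → EReal) (lam α : ℝ)
    (f1 f2 : EuclideanSpace ℝ (Fin n) → EReal) (x : EuclideanSpace ℝ (Fin n)) : EReal :=
  esub
    (fconj (fun y =>
      (α : EReal) * fconj (fun z => f1 z + ((1 / lam : ℝ) : EReal) * φ z) y
        + ((1 - α : ℝ) : EReal) * fconj (fun z => f2 z + ((1 / lam : ℝ) : EReal) * φ z) y) x)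
    (((1 / lam : ℝ) : EReal) * φ x)

/-- Argmin set of an extended-real-valued function. -/
def argminSet {n : ℕ} (f : EuclideanSpace ℝ (Fin n) → EReal) :
    Set (EuclideanSpace ℝ (Fin n)) :=
  {x | f x ≠ ⊤ ∧ ∀ y, f x ≤ f y}

section
variable {E : Type*} [NormedAddCommGroup E] [InnerProductSpace ℝ E]

/-- A function continuous on a convex set and convex on its nonempty interior is convex on the
whole set. -/
lemma ConvexOn.of_interior {F : Type*} [NormedAddCommGroup F] [NormedSpace ℝ F] {s : Set F}
    {f : F → ℝ} (hs : Convex ℝ s) (hne : (interior s).Nonempty) (hc : ContinuousOn f s)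
    (hf : ConvexOn ℝ (interior s) f) : ConvexOn ℝ s f := by
  obtain ⟨p, hp⟩ := hne
  have key : ∀ x ∈ s, Filter.Tendsto (fun t : ℝ => f (x + t • (p - x))) (𝓝[>] 0) (𝓝 (f x)) := by
    intro x hx
    have h1 : Filter.Tendsto (fun t : ℝ => x + t • (p - x)) (𝓝[>] 0) (𝓝[s] x) := by
      refine tendsto_nhdsWithin_iff.2 ⟨?_, ?_⟩
      · have : Continuous fun t : ℝ => x + t • (p - x) := by fun_prop
        simpa using (this.tendsto 0).mono_left nhdsWithin_le_nhds
      · filter_upwards [Ioc_mem_nhdsGT (zero_lt_one (α := ℝ))] with t ht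
        exact interior_subset (hs.add_smul_sub_mem_interior hx hp ht)
    exact (hc x hx).tendsto.comp h1
  refine ⟨hs, fun x hx y hy a b ha hb hab => ?_⟩
  refine le_of_tendsto_of_tendsto (key _ (hs hx hy ha hb hab))
    (((key x hx).const_mul a).add ((key y hy).const_mul b)) ?_
  filter_upwards [Ioc_mem_nhdsGT (zero_lt_one (α := ℝ))] with t ht
  have h := hf.2 (hs.add_smul_sub_mem_interior hx hp ht)
    (hs.add_smul_sub_mem_interior hy hp ht) ha hb hab
  have e : a • x + b • y + t • (p - (a • x + b • y))
      = a • (x + t • (p - x)) + b • (y + t • (p - y)) := by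
    obtain rfl : b = 1 - a := by linarith
    module
  rw [e]
  exact h

/-- Convexity of the symmetrized Bregman distance forces joint convexity of the second-order form
`(x, u) ↦ ⟪H x u, u⟫`. -/
lemma hessian_form_convex {U : Set E} (hU : IsOpen U) {g : E → E} {H : E → E →L[ℝ] E}
    (hH : ∀ x ∈ U, HasFDerivAt g (H x) x)
    (hS : ConvexOn ℝ (U ×ˢ U) fun p : E × E => ⟪g p.1 - g p.2, p.1 - p.2⟫)
    {x y u v : E} (hx : x ∈ U) (hy : y ∈ U) {a b : ℝ} (ha : 0 ≤ a) (hb : 0 ≤ b)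
    (hab : a + b = 1) :
    ⟪H (a • x + b • y) (a • u + b • v), a • u + b • v⟫
      ≤ a * ⟪H x u, u⟫ + b * ⟪H y v, v⟫ := by
  have hUc : Convex ℝ U := by
    intro p hp q hq c d hc hd hcd
    exact (hS.1 (Set.mk_mem_prod hp hp) (Set.mk_mem_prod hq hq) hc hd hcd).1
  have hz := hUc hx hy ha hb hab
  have lim : ∀ p ∈ U, ∀ w : E, Filter.Tendsto
      (fun t : ℝ => t⁻¹ * t⁻¹ * ⟪g p - g (p + t • w), p - (p + t • w)⟫) (𝓝[>] 0)
      (𝓝 ⟪H p w, w⟫) := by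
    intro p hp w
    have h1 := ((hH p hp).hasLineDerivAt w).tendsto_slope_zero_right
    have h2 := h1.inner (𝕜 := ℝ) (tendsto_const_nhds (x := w))
    refine h2.congr' ?_
    filter_upwards [self_mem_nhdsWithin] with t ht
    have ht' : t ≠ 0 := ne_of_gt ht
    rw [show p - (p + t • w) = -(t • w) by abel, show g p - g (p + t • w) =
      -(g (p + t • w) - g p) by abel, inner_neg_neg, real_inner_smul_left, real_inner_smul_right]
    field_simp
  have ev : ∀ p ∈ U, ∀ w : E, ∀ᶠ t : ℝ in 𝓝[>] 0, p + t • w ∈ U := by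
    intro p hp w
    have : Continuous fun t : ℝ => p + t • w := by fun_prop
    refine nhdsWithin_le_nhds (this.continuousAt.preimage_mem_nhds (hU.mem_nhds (by simpa)))
  refine le_of_tendsto_of_tendsto (lim _ hz _) (((lim x hx u).const_mul a).add
    ((lim y hy v).const_mul b)) ?_
  filter_upwards [ev x hx u, ev y hy v] with t h1 h2
  have h := hS.2 (Set.mk_mem_prod hx h1) (Set.mk_mem_prod hy h2) ha hb hab
  have e : a • x + b • y + t • (a • u + b • v) = a • (x + t • u) + b • (y + t • v) := by module
  simp only [Prod.smul_mk, Prod.mk_add_mk, smul_eq_mul] at h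
  rw [e]
  have h0 := mul_le_mul_of_nonneg_left h (mul_self_nonneg t⁻¹)
  linarith

/-- The Jensen gap of `Φ` is jointly convex if its gradient has convex symmetrized Bregman
distance. -/
lemma jensenGap_convexOn [CompleteSpace E] {U : Set E} (hU : IsOpen U) {Φ : E → ℝ} {g : E → E}
    {H : E → E →L[ℝ] E}
    (hg : ∀ x ∈ U, HasGradientAt Φ (g x) x) (hH : ∀ x ∈ U, HasFDerivAt g (H x) x)
    (hS : ConvexOn ℝ (U ×ˢ U) fun p : E × E => ⟪g p.1 - g p.2, p.1 - p.2⟫)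
    {α β : ℝ} (hα : 0 ≤ α) (hβ : 0 ≤ β) (hαβ : α + β = 1) :
    ConvexOn ℝ (U ×ˢ U)
      fun p : E × E => α * Φ p.1 + β * Φ p.2 - Φ (α • p.1 + β • p.2) := by
  have hUc : Convex ℝ U := by
    intro p hp q hq c d hc hd hcd
    exact (hS.1 (Set.mk_mem_prod hp hp) (Set.mk_mem_prod hq hq) hc hd hcd).1
  have hline : ∀ (x u : E) (s : ℝ), HasDerivAt (fun s : ℝ => x + s • u) u s := by
    intro x u s
    simpa using ((hasDerivAt_id s).smul_const u).const_add x
  have d1 : ∀ (x u : E) (s : ℝ), x + s • u ∈ U →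
      HasDerivAt (fun s : ℝ => Φ (x + s • u)) ⟪g (x + s • u), u⟫ s := by
    intro x u s hs
    exact (hg _ hs).hasFDerivAt.comp_hasDerivAt s (hline x u s)
  have d2 : ∀ (x u : E) (s : ℝ), x + s • u ∈ U →
      HasDerivAt (fun s : ℝ => ⟪g (x + s • u), u⟫) ⟪H (x + s • u) u, u⟫ s := by
    intro x u s hs
    have := ((hH _ hs).comp_hasDerivAt s (hline x u s)).inner ℝ (hasDerivAt_const s u)
    simpa using this
  refine ⟨hS.1, ?_⟩
  rintro ⟨x₁, x₂⟩ ⟨hx₁, hx₂⟩ ⟨y₁, y₂⟩ ⟨hy₁, hy₂⟩ a b ha hb hab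
  have mem : ∀ {x y : E}, x ∈ U → y ∈ U → ∀ s ∈ Set.Icc (0 : ℝ) 1, x + s • (y - x) ∈ U :=
    fun hx hy s hs => hUc.add_smul_sub_mem hx hy hs
  set u := y₁ - x₁ with hu
  set v := y₂ - x₂ with hv
  have hz : ∀ s ∈ Set.Icc (0 : ℝ) 1, α • x₁ + β • x₂ + s • (α • u + β • v) ∈ U := by
    intro s hs
    have := hUc (mem hx₁ hy₁ s hs) (mem hx₂ hy₂ s hs) hα hβ hαβ
    convert this using 1
    module
  let F : ℝ → ℝ := fun s => α * Φ (x₁ + s • u) + β * Φ (x₂ + s • v)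
    - Φ (α • x₁ + β • x₂ + s • (α • u + β • v))
  have hF1 : ∀ s ∈ Set.Icc (0 : ℝ) 1, HasDerivAt F (α * ⟪g (x₁ + s • u), u⟫
      + β * ⟪g (x₂ + s • v), v⟫ - ⟪g (α • x₁ + β • x₂ + s • (α • u + β • v)), α • u + β • v⟫) s :=
    fun s hs => (((d1 _ _ s (mem hx₁ hy₁ s hs)).const_mul α).add
      ((d1 _ _ s (mem hx₂ hy₂ s hs)).const_mul β)).sub (d1 _ _ s (hz s hs))
  have hF : ConvexOn ℝ (Set.Icc (0 : ℝ) 1) F := by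
    refine convexOn_of_hasDerivWithinAt2_nonneg (convex_Icc 0 1)
      (fun s hs => (hF1 s hs).continuousAt.continuousWithinAt)
      (fun s hs => (hF1 s (interior_subset hs)).hasDerivWithinAt)
      (f'' := fun s => α * ⟪H (x₁ + s • u) u, u⟫
        + β * ⟪H (x₂ + s • v) v, v⟫
        - ⟪H (α • x₁ + β • x₂ + s • (α • u + β • v)) (α • u + β • v), α • u + β • v⟫)
      (fun s hs => ?_) (fun s hs => ?_)
    · have hs := interior_subset hs
      exact ((((d2 _ _ s (mem hx₁ hy₁ s hs)).const_mul α).add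
        ((d2 _ _ s (mem hx₂ hy₂ s hs)).const_mul β)).sub (d2 _ _ s (hz s hs))).hasDerivWithinAt
    · have hs := interior_subset hs
      have := hessian_form_convex hU hH hS (u := u) (v := v) (mem hx₁ hy₁ s hs)
        (mem hx₂ hy₂ s hs) hα hβ hαβ
      have e : α • x₁ + β • x₂ + s • (α • u + β • v)
          = α • (x₁ + s • u) + β • (x₂ + s • v) := by module
      rw [e]
      linarith
  have h := hF.2 (Set.left_mem_Icc.2 zero_le_one) (Set.right_mem_Icc.2 zero_le_one) ha hb hab
  obtain rfl : a = 1 - b := by linarith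
  have e0 : F 0 = α * Φ x₁ + β * Φ x₂ - Φ (α • x₁ + β • x₂) := by simp [F]
  have e1 : F 1 = α * Φ y₁ + β * Φ y₂ - Φ (α • y₁ + β • y₂) := by
    simp only [F]
    rw [show x₁ + (1 : ℝ) • u = y₁ by rw [hu]; module,
      show x₂ + (1 : ℝ) • v = y₂ by rw [hv]; module,
      show α • x₁ + β • x₂ + (1 : ℝ) • (α • u + β • v) = α • y₁ + β • y₂ by rw [hu, hv]; module]
  have e2 : F ((1 - b) • 0 + b • 1) = α * Φ ((1 - b) • x₁ + b • y₁) + β * Φ ((1 - b) • x₂ + b • y₂)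
      - Φ (α • ((1 - b) • x₁ + b • y₁) + β • ((1 - b) • x₂ + b • y₂)) := by
    rw [show (1 - b) • (0 : ℝ) + b • (1 : ℝ) = b by simp]
    simp only [F]
    rw [show x₁ + b • u = (1 - b) • x₁ + b • y₁ by rw [hu]; module,
      show x₂ + b • v = (1 - b) • x₂ + b • y₂ by rw [hv]; module,
      show α • x₁ + β • x₂ + b • (α • u + β • v)
        = α • ((1 - b) • x₁ + b • y₁) + β • ((1 - b) • x₂ + b • y₂) by rw [hu, hv]; module]
  rw [e0, e1, e2] at h
  exact h
end

/-- The real epigraph of an extended-real-valued function. -/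
def epigraph {n : ℕ} (f : EuclideanSpace ℝ (Fin n) → EReal) :
    Set (EuclideanSpace ℝ (Fin n) × ℝ) :=
  {p | f p.1 ≤ (p.2 : EReal)}

lemma ConvexFn.convex_epigraph {n : ℕ} {f : EuclideanSpace ℝ (Fin n) → EReal} (hf : ConvexFn f) :
    Convex ℝ (epigraph f) := by
  rintro ⟨x, r⟩ hx ⟨y, s⟩ hy a b ha hb hab
  simp only [epigraph, Set.mem_ofPred_eq, Prod.smul_mk, Prod.mk_add_mk, smul_eq_mul] at hx hy ⊢
  refine (hf x y a b ha hb hab).trans ?_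
  push_cast
  exact add_le_add (mul_le_mul_of_nonneg_left hx (EReal.coe_nonneg.2 ha))
    (mul_le_mul_of_nonneg_left hy (EReal.coe_nonneg.2 hb))

lemma ConvexFn.convex_edom {n : ℕ} {f : EuclideanSpace ℝ (Fin n) → EReal} (hf : ConvexFn f)
    (hbot : ∀ x, f x ≠ ⊥) : Convex ℝ (edom f) := by
  intro x hx y hy a b ha hb hab
  have h := hf x y a b ha hb hab
  rw [← EReal.coe_toReal hx (hbot x), ← EReal.coe_toReal hy (hbot y), ← EReal.coe_mul,
    ← EReal.coe_mul, ← EReal.coe_add] at h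
  exact ne_top_of_le_ne_top (EReal.coe_ne_top _) h

lemma convexFn_of_convex_epigraph {n : ℕ} {f : EuclideanSpace ℝ (Fin n) → EReal}
    (hbot : ∀ x, f x ≠ ⊥) (hf : Convex ℝ (epigraph f)) : ConvexFn f := by
  intro x y a b ha hb hab
  rcases ha.eq_or_lt with rfl | ha'
  · obtain rfl : b = 1 := by linarith
    simp
  rcases hb.eq_or_lt with rfl | hb'
  · obtain rfl : a = 1 := by linarith
    simp
  have hmul : ∀ c : ℝ, 0 < c → ∀ z, (c : EReal) * f z ≠ ⊥ := by
    intro c hc z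
    rw [Ne, EReal.mul_eq_bot]
    simp [hbot z, hc.le]
  by_cases hx : f x = ⊤
  · rw [hx, EReal.coe_mul_top_of_pos ha', EReal.top_add_of_ne_bot (hmul b hb' y)]
    exact le_top
  by_cases hy : f y = ⊤
  · rw [hy, EReal.coe_mul_top_of_pos hb', EReal.add_top_of_ne_bot (hmul a ha' x)]
    exact le_top
  have hx' : (x, (f x).toReal) ∈ epigraph f := (EReal.coe_toReal hx (hbot x)).ge
  have hy' : (y, (f y).toReal) ∈ epigraph f := (EReal.coe_toReal hy (hbot y)).ge
  have h := hf hx' hy' ha hb hab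
  simp only [epigraph, Set.mem_ofPred_eq, Prod.smul_mk, Prod.mk_add_mk, smul_eq_mul] at h
  push_cast at h
  rwa [EReal.coe_toReal hx (hbot x), EReal.coe_toReal hy (hbot y)] at h

lemma LowerSemicontinuous.isClosed_real_epigraph {n : ℕ} {f : EuclideanSpace ℝ (Fin n) → EReal}
    (hf : LowerSemicontinuous f) : IsClosed (epigraph f) :=
  hf.isClosed_epigraph.preimage
    (continuous_fst.prodMk (continuous_coe_real_ereal.comp continuous_snd))

lemma add_mem_epigraph {n : ℕ} {f : EuclideanSpace ℝ (Fin n) → EReal}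
    {p : EuclideanSpace ℝ (Fin n) × ℝ} (hp : p ∈ epigraph f) {t : ℝ} (ht : 0 ≤ t) :
    (p.1, p.2 + t) ∈ epigraph f :=
  le_trans (b := (p.2 : EReal)) hp (EReal.coe_le_coe_iff.2 (by simpa using ht))

lemma EReal.add_coe_mul_le_coe_iff {a b : EReal} {μ r : ℝ} (hμ : 0 < μ) (ha : a ≠ ⊥) (hb : b ≠ ⊥) :
    a + (μ : EReal) * b ≤ (r : EReal) ↔ ∃ t : ℝ, b = t ∧ a ≤ ((r - μ * t : ℝ) : EReal) := by
  induction b with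
  | bot => exact absurd rfl hb
  | top =>
    rw [EReal.coe_mul_top_of_pos hμ, EReal.add_top_of_ne_bot ha]
    simp
  | coe t =>
    induction a with
    | bot => exact absurd rfl ha
    | top =>
      rw [← EReal.coe_mul, EReal.top_add_coe]
      simp [-EReal.coe_sub, -EReal.coe_mul]
    | coe s =>
      constructor
      · intro h
        refine ⟨t, rfl, ?_⟩
        norm_cast at h ⊢
        linarith
      · rintro ⟨t', ht, h⟩
        obtain rfl : t = t' := by exact_mod_cast ht
        norm_cast at h ⊢
        linarith

/-- Separation of a point from a closed, convex, upward closed subset of `V × ℝ`. -/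
lemma exists_separating_of_notMem {V : Type*} [NormedAddCommGroup V] [InnerProductSpace ℝ V]
    [CompleteSpace V] {K : Set (V × ℝ)} (hconv : Convex ℝ K) (hcl : IsClosed K)
    (hne : K.Nonempty) (hup : ∀ p ∈ K, ∀ t : ℝ, 0 ≤ t → (p.1, p.2 + t) ∈ K)
    {x : V} {r : ℝ} (hn : (x, r) ∉ K) :
    ∃ (y : V) (t u : ℝ), 0 ≤ t ∧ (∀ p ∈ K, u < ⟪y, p.1⟫ + t * p.2) ∧ ⟪y, x⟫ + t * r < u := by
  obtain ⟨l, u, hlt, hl⟩ := geometric_hahn_banach_point_closed hconv hcl hn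
  have hform : ∀ p : V × ℝ, l p = ⟪(InnerProductSpace.toDual ℝ V).symm
      (l.comp (ContinuousLinearMap.inl ℝ V ℝ)), p.1⟫ + l (0, 1) * p.2 := by
    rintro ⟨z, s⟩
    rw [InnerProductSpace.toDual_symm_apply]
    have : (z, s) = (z, (0 : ℝ)) + s • ((0 : V), (1 : ℝ)) := by simp
    rw [this, map_add, map_smul]
    simp [mul_comm]
  refine ⟨_, l (0, 1), u, ?_, fun p hp => (hform p) ▸ hl p hp, (hform (x, r)) ▸ hlt⟩
  obtain ⟨p, hp⟩ := hne
  by_contra! hneg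
  have hbd : ∀ t : ℝ, 0 ≤ t → u < l p + l (0, 1) * t := by
    intro t ht
    have := hl _ (hup p hp t ht)
    rw [hform] at this ⊢
    simp only at this
    linarith
  have hp0 := hl p hp
  have h := hbd ((l p - u) / -l (0, 1)) (div_nonneg (by linarith) (by linarith))
  have : l (0, 1) * ((l p - u) / -l (0, 1)) = -(l p - u) := by
    have := hneg.ne
    field_simp
  linarith

/-- A point outside a closed, convex, upward closed set whose height is bounded below lies strictly
below a nonvertical affine minorant of that set. -/
lemma exists_affine_minorant_of_notMem {V : Type*} [NormedAddCommGroup V] [InnerProductSpace ℝ V]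
    [CompleteSpace V] {K : Set (V × ℝ)} (hconv : Convex ℝ K) (hcl : IsClosed K)
    (hne : K.Nonempty) (hup : ∀ p ∈ K, ∀ t : ℝ, 0 ≤ t → (p.1, p.2 + t) ∈ K) {m : ℝ}
    (hm : ∀ p ∈ K, m ≤ p.2) {x : V} {r : ℝ} (hn : (x, r) ∉ K) :
    ∃ (y : V) (c : ℝ), (∀ p ∈ K, ⟪y, p.1⟫ + c ≤ p.2) ∧ r < ⟪y, x⟫ + c := by
  obtain ⟨y, t, u, ht, hK, hx⟩ := exists_separating_of_notMem hconv hcl hne hup hn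
  rcases ht.eq_or_lt with rfl | ht
  · simp only [zero_mul, add_zero] at hK hx
    have hpos : 0 < u - ⟪y, x⟫ := by linarith
    set k := (|r - m| + 1) / (u - ⟪y, x⟫) with hk
    have hk0 : 0 ≤ k := by positivity
    have hkx : k * (u - ⟪y, x⟫) = |r - m| + 1 := div_mul_cancel₀ _ hpos.ne'
    refine ⟨-k • y, k * u + m, fun p hp => ?_, ?_⟩
    · rw [real_inner_smul_left]
      nlinarith [hK p hp, hm p hp, mul_nonneg hk0 (sub_nonneg.2 (hK p hp).le)]
    · rw [real_inner_smul_left]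
      nlinarith [le_abs_self (r - m)]
  · refine ⟨-t⁻¹ • y, t⁻¹ * u, fun p hp => ?_, ?_⟩
    · rw [real_inner_smul_left]
      have := mul_lt_mul_of_pos_left (hK p hp) (inv_pos.2 ht)
      rw [mul_add, inv_mul_cancel_left₀ ht.ne'] at this
      linarith
    · rw [real_inner_smul_left]
      have := mul_lt_mul_of_pos_left hx (inv_pos.2 ht)
      rw [mul_add, inv_mul_cancel_left₀ ht.ne'] at this
      linarith

lemma Gamma0.exists_affine_minorant {n : ℕ} {f : EuclideanSpace ℝ (Fin n) → EReal}
    (hf : Gamma0 f) :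
    ∃ (y : EuclideanSpace ℝ (Fin n)) (c : ℝ), ∀ z, ((⟪y, z⟫ + c : ℝ) : EReal) ≤ f z := by
  obtain ⟨⟨hbot, x, hx⟩, hlsc, hconv⟩ := hf
  have hxr := EReal.coe_toReal hx (hbot x)
  set r := (f x).toReal
  have hmem : (x, r) ∈ epigraph f := hxr.ge
  have hn : (x, r - 1) ∉ epigraph f := by
    simp only [epigraph, Set.mem_ofPred_eq, ← hxr, EReal.coe_le_coe_iff]
    linarith
  obtain ⟨y, t, u, ht, hK, hx⟩ := exists_separating_of_notMem hconv.convex_epigraph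
    hlsc.isClosed_real_epigraph ⟨_, hmem⟩ (fun p hp t ht => add_mem_epigraph hp ht) hn
  have ht : 0 < t := by
    have := hK _ hmem
    simp only at this
    nlinarith
  refine ⟨-t⁻¹ • y, t⁻¹ * u, fun z => ?_⟩
  by_cases hz : f z = ⊤
  · simp [hz]
  have hzr := EReal.coe_toReal hz (hbot z)
  have hzK : (z, (f z).toReal) ∈ epigraph f := hzr.ge
  rw [← hzr, EReal.coe_le_coe_iff, real_inner_smul_left]
  have := mul_lt_mul_of_pos_left (hK _ hzK) (inv_pos.2 ht)
  rw [mul_add, inv_mul_cancel_left₀ ht.ne'] at this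
  linarith

/-- A supercoercive function in `Γ₀` dominates every multiple of the norm up to a constant. -/
lemma SuperCoercive.exists_norm_sub_le {n : ℕ} {φ : EuclideanSpace ℝ (Fin n) → EReal}
    (hco : SuperCoercive φ) (hφ : Gamma0 φ) (M : ℝ) :
    ∃ C : ℝ, ∀ z, ((M * ‖z‖ - C : ℝ) : EReal) ≤ φ z := by
  obtain ⟨R, hR⟩ := hco M
  obtain ⟨y, c, hy⟩ := hφ.exists_affine_minorant
  refine ⟨|M| * |R| + ‖y‖ * |R| + |c|, fun z => ?_⟩
  have hp1 : 0 ≤ |M| * |R| := by positivity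
  have hp2 : 0 ≤ ‖y‖ * |R| := by positivity
  rcases le_total R ‖z‖ with h | h
  · refine le_trans (EReal.coe_le_coe_iff.2 ?_) (hR z h)
    linarith [abs_nonneg c]
  · refine le_trans (EReal.coe_le_coe_iff.2 ?_) (hy z)
    have hz : ‖z‖ ≤ |R| := h.trans (le_abs_self R)
    have h1 : M * ‖z‖ ≤ |M| * |R| :=
      mul_le_mul (le_abs_self M) hz (norm_nonneg _) (abs_nonneg _)
    have h2 : -(‖y‖ * |R|) ≤ ⟪y, z⟫ := by
      have := (abs_le.1 (abs_real_inner_le_norm y z)).1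
      have := mul_le_mul_of_nonneg_left hz (norm_nonneg y)
      linarith
    linarith [neg_abs_le c]

/-- Adding a positive multiple of a supercoercive function to a function in `Γ₀` gives a function
growing faster than any multiple of the norm. -/
lemma Gamma0.exists_norm_sub_le_add {n : ℕ} {f φ : EuclideanSpace ℝ (Fin n) → EReal}
    (hf : Gamma0 f) (hφ : Gamma0 φ) (hco : SuperCoercive φ) {μ : ℝ} (hμ : 0 < μ) (M : ℝ) :
    ∃ C : ℝ, ∀ z, ((M * ‖z‖ - C : ℝ) : EReal) ≤ f z + (μ : EReal) * φ z := by
  obtain ⟨y, c, hy⟩ := hf.exists_affine_minorant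
  obtain ⟨C, hC⟩ := hco.exists_norm_sub_le hφ ((M + ‖y‖) / μ)
  refine ⟨μ * C - c, fun z => ?_⟩
  have h := add_le_add (hy z) (mul_le_mul_of_nonneg_left (hC z) (EReal.coe_nonneg.2 hμ.le))
  refine le_trans ?_ h
  rw [← EReal.coe_mul, ← EReal.coe_add, EReal.coe_le_coe_iff]
  have e : μ * ((M + ‖y‖) / μ * ‖z‖ - C) = (M + ‖y‖) * ‖z‖ - μ * C := by field_simp
  rw [e]
  linarith [(abs_le.1 (abs_real_inner_le_norm y z)).1]

lemma LowerSemicontinuous.add_coe_mul {n : ℕ} {f φ : EuclideanSpace ℝ (Fin n) → EReal}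
    (hf : LowerSemicontinuous f) (hφ : LowerSemicontinuous φ) (hfb : ∀ x, f x ≠ ⊥)
    (hφb : ∀ x, φ x ≠ ⊥) {μ : ℝ} (hμ : 0 < μ) :
    LowerSemicontinuous fun z => f z + (μ : EReal) * φ z := by
  have hcont : Continuous fun a : EReal => (μ : EReal) * a :=
    continuous_iff_continuousAt.2 fun a => EReal.Tendsto.const_mul Filter.tendsto_id
      (.inl (EReal.coe_ne_bot μ)) (.inl (EReal.coe_ne_top μ))
  have hmono : Monotone fun a : EReal => (μ : EReal) * a :=
    fun a b h => mul_le_mul_of_nonneg_left h (EReal.coe_nonneg.2 hμ.le)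
  refine hf.add' (hcont.comp_lowerSemicontinuous hφ hmono) fun x => ?_
  refine EReal.continuousAt_add (.inr ?_) (.inl (hfb x))
  dsimp only
  rw [Ne, EReal.mul_eq_bot]
  simp [hφb x, hμ.le]

lemma convex_epigraph_add_coe_mul {n : ℕ} {f φ : EuclideanSpace ℝ (Fin n) → EReal}
    (hf : ConvexFn f) (hφ : ConvexFn φ) (hfb : ∀ x, f x ≠ ⊥)
    (hφb : ∀ x, φ x ≠ ⊥) {μ : ℝ} (hμ : 0 < μ) :
    Convex ℝ (epigraph fun z => f z + (μ : EReal) * φ z) := by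
  rintro ⟨x, r⟩ hx ⟨y, s⟩ hy a b ha hb hab
  simp only [epigraph, Set.mem_ofPred_eq, Prod.smul_mk, Prod.mk_add_mk, smul_eq_mul] at hx hy ⊢
  obtain ⟨p, hp, hx⟩ := (EReal.add_coe_mul_le_coe_iff hμ (hfb x) (hφb x)).1 hx
  obtain ⟨q, hq, hy⟩ := (EReal.add_coe_mul_le_coe_iff hμ (hfb y) (hφb y)).1 hy
  have h1 := hf.convex_epigraph (show (x, r - μ * p) ∈ epigraph f from hx)
    (show (y, s - μ * q) ∈ epigraph f from hy) ha hb hab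
  have h2 := hφ.convex_epigraph (show (x, p) ∈ epigraph φ from hp.le)
    (show (y, q) ∈ epigraph φ from hq.le) ha hb hab
  refine (add_le_add h1 (mul_le_mul_of_nonneg_left h2 (EReal.coe_nonneg.2 hμ.le))).trans ?_
  rw [← EReal.coe_mul, ← EReal.coe_add, EReal.coe_le_coe_iff]
  simp only [Prod.smul_mk, Prod.mk_add_mk, smul_eq_mul]
  linarith

/-- The conjugate of a function of superlinear growth is finite, and is the supremum of
`⟪y, x⟫ - r` over the epigraph. -/
lemma exists_fconj_eq_coe {n : ℕ} {h : EuclideanSpace ℝ (Fin n) → EReal}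
    (hg : ∀ M : ℝ, ∃ C : ℝ, ∀ z, ((M * ‖z‖ - C : ℝ) : EReal) ≤ h z) (hne : (epigraph h).Nonempty)
    (y : EuclideanSpace ℝ (Fin n)) :
    ∃ m : ℝ, fconj h y = m ∧ (∀ p ∈ epigraph h, ⟪y, p.1⟫ - p.2 ≤ m) ∧
      ∀ ε > 0, ∃ p ∈ epigraph h, m - ε < ⟪y, p.1⟫ - p.2 := by
  obtain ⟨C, hC⟩ := hg ‖y‖
  have hle : ∀ p ∈ epigraph h, ((⟪y, p.1⟫ - p.2 : ℝ) : EReal) ≤ fconj h y := by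
    intro p hp
    rw [EReal.coe_sub]
    exact (EReal.sub_le_sub le_rfl hp).trans
      (le_iSup (fun x => ((⟪y, x⟫ : ℝ) : EReal) - h x) p.1)
  have htop : fconj h y ≠ ⊤ := by
    refine ne_top_of_le_ne_top (EReal.coe_ne_top C) (iSup_le fun x => ?_)
    refine (EReal.sub_le_sub le_rfl (hC x)).trans ?_
    rw [← EReal.coe_sub, EReal.coe_le_coe_iff]
    linarith [real_inner_le_norm y x]
  have hbot : fconj h y ≠ ⊥ := by
    obtain ⟨p, hp⟩ := hne
    exact ne_bot_of_le_ne_bot (EReal.coe_ne_bot _) (hle p hp)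
  have hm := EReal.coe_toReal htop hbot
  refine ⟨(fconj h y).toReal, hm.symm, fun p hp => ?_, fun ε hε => ?_⟩
  · have := hle p hp
    rwa [← hm, EReal.coe_le_coe_iff] at this
  · have hlt : (((fconj h y).toReal - ε : ℝ) : EReal) < fconj h y := by
      conv_rhs => rw [← hm]
      exact EReal.coe_lt_coe_iff.2 (by linarith)
    obtain ⟨x, hx⟩ := lt_iSup_iff.1 hlt
    have hxb : h x ≠ ⊥ := ne_bot_of_le_ne_bot (EReal.coe_ne_bot _) (hC x)
    have hxt : h x ≠ ⊤ := by
      rintro h0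
      simp [h0] at hx
    have hxr := EReal.coe_toReal hxt hxb
    refine ⟨(x, (h x).toReal), hxr.ge, ?_⟩
    rw [← hxr, ← EReal.coe_sub, EReal.coe_lt_coe_iff] at hx
    exact hx

/-- The `α`-weighted Minkowski combination of two epigraphs. -/
def epiCombo {n : ℕ} (α : ℝ) (h₁ h₂ : EuclideanSpace ℝ (Fin n) → EReal) :
    Set (EuclideanSpace ℝ (Fin n) × ℝ) :=
  α • epigraph h₁ + (1 - α) • epigraph h₂

lemma mem_epiCombo {n : ℕ} {α : ℝ} {h₁ h₂ : EuclideanSpace ℝ (Fin n) → EReal}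
    {p : EuclideanSpace ℝ (Fin n) × ℝ} :
    p ∈ epiCombo α h₁ h₂ ↔
      ∃ q₁ ∈ epigraph h₁, ∃ q₂ ∈ epigraph h₂, α • q₁ + (1 - α) • q₂ = p := by
  simp [epiCombo, Set.mem_add, Set.mem_smul_set]

lemma isClosed_epiCombo {n : ℕ} {α : ℝ} (hα0 : 0 ≤ α) (hα1 : α ≤ 1)
    {h₁ h₂ : EuclideanSpace ℝ (Fin n) → EReal} (hcl₁ : IsClosed (epigraph h₁))
    (hcl₂ : IsClosed (epigraph h₂)) (hne₁ : (epigraph h₁).Nonempty)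
    (hne₂ : (epigraph h₂).Nonempty)
    (hg₁ : ∀ M : ℝ, ∃ C : ℝ, ∀ z, ((M * ‖z‖ - C : ℝ) : EReal) ≤ h₁ z)
    (hg₂ : ∀ M : ℝ, ∃ C : ℝ, ∀ z, ((M * ‖z‖ - C : ℝ) : EReal) ≤ h₂ z) :
    IsClosed (epiCombo α h₁ h₂) := by
  rcases hα0.eq_or_lt with rfl | hα0
  · simpa [epiCombo, Set.zero_smul_set hne₁] using hcl₂
  rcases hα1.eq_or_lt with rfl | hα1
  · simpa [epiCombo, Set.zero_smul_set hne₂] using hcl₁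
  have hβ0 : 0 < 1 - α := by linarith
  obtain ⟨C₁, hC₁⟩ := hg₁ 1
  obtain ⟨C₂, hC₂⟩ := hg₂ 1
  have low : ∀ {h : EuclideanSpace ℝ (Fin n) → EReal} {C : ℝ},
      (∀ z, ((1 * ‖z‖ - C : ℝ) : EReal) ≤ h z) → ∀ p ∈ epigraph h, ‖p.1‖ - C ≤ p.2 := by
    intro h C hC p hp
    have := EReal.coe_le_coe_iff.1 ((hC p.1).trans hp)
    linarith
  have bdd : ∀ {a : ℝ} {p : EuclideanSpace ℝ (Fin n) × ℝ} {C D : ℝ}, 0 < a → ‖p.1‖ - C ≤ p.2 →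
      a * p.2 ≤ D → ‖p‖ ≤ |C| + |D / a| := by
    intro a p C D ha hC hD
    have h1 : p.2 ≤ D / a := by rwa [le_div_iff₀' ha]
    have := le_abs_self C
    have := le_abs_self (D / a)
    have := abs_nonneg C
    have := abs_nonneg (D / a)
    have := norm_nonneg p.1
    rw [Prod.norm_def]
    refine max_le (by linarith) ?_
    rw [Real.norm_eq_abs, abs_le]
    constructor <;> linarith
  refine IsSeqClosed.isClosed fun w p hw hlim => ?_
  choose q₁ hq₁ q₂ hq₂ hq using fun k => mem_epiCombo.1 (hw k)
  obtain ⟨B, hB⟩ := (Metric.isBounded_range_of_tendsto w hlim).exists_norm_le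
  have hsum : ∀ k, α * (q₁ k).2 + (1 - α) * (q₂ k).2 ≤ B := by
    intro k
    have h1 : ‖(w k).2‖ ≤ B := (norm_snd_le (w k)).trans (hB _ ⟨k, rfl⟩)
    rw [← hq k] at h1
    simpa using (le_abs_self _).trans h1
  have hl₁ : ∀ k, ‖(q₁ k).1‖ - C₁ ≤ (q₁ k).2 := fun k => low hC₁ _ (hq₁ k)
  have hl₂ : ∀ k, ‖(q₂ k).1‖ - C₂ ≤ (q₂ k).2 := fun k => low hC₂ _ (hq₂ k)
  have hb₁ : ∀ k, ‖q₁ k‖ ≤ |C₁| + |(B + (1 - α) * C₂) / α| := fun k =>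
    bdd hα0 (hl₁ k) (by nlinarith [hsum k, hl₂ k, norm_nonneg (q₂ k).1])
  have hb₂ : ∀ k, ‖q₂ k‖ ≤ |C₂| + |(B + α * C₁) / (1 - α)| := fun k =>
    bdd hβ0 (hl₂ k) (by nlinarith [hsum k, hl₁ k, norm_nonneg (q₁ k).1])
  have hbd : ∀ k, (q₁ k, q₂ k) ∈ Metric.closedBall
      (0 : EuclideanSpace ℝ (Fin n) × ℝ) (|C₁| + |(B + (1 - α) * C₂) / α|) ×ˢ
      Metric.closedBall (0 : EuclideanSpace ℝ (Fin n) × ℝ) (|C₂| + |(B + α * C₁) / (1 - α)|) :=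
    fun k => ⟨mem_closedBall_zero_iff.2 (hb₁ k), mem_closedBall_zero_iff.2 (hb₂ k)⟩
  obtain ⟨⟨a₁, a₂⟩, -, ψ, hψ, hconv⟩ := tendsto_subseq_of_bounded
    (Metric.isBounded_closedBall.prod Metric.isBounded_closedBall) hbd
  have hc₁ : Filter.Tendsto (fun k => q₁ (ψ k)) Filter.atTop (𝓝 a₁) :=
    (continuous_fst.tendsto _).comp hconv
  have hc₂ : Filter.Tendsto (fun k => q₂ (ψ k)) Filter.atTop (𝓝 a₂) :=
    (continuous_snd.tendsto _).comp hconv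
  refine mem_epiCombo.2 ⟨a₁, hcl₁.mem_of_tendsto hc₁ (.of_forall fun k => hq₁ _),
    a₂, hcl₂.mem_of_tendsto hc₂ (.of_forall fun k => hq₂ _), ?_⟩
  refine tendsto_nhds_unique ((hc₁.const_smul α).add (hc₂.const_smul (1 - α)))
    ((hlim.comp hψ.tendsto_atTop).congr fun k => (hq _).symm)

/-- The conjugate of a convex combination of conjugates has the Minkowski combination of the
epigraphs as its epigraph. -/
lemma epigraph_fconj_combo {n : ℕ} {α : ℝ} (hα0 : 0 ≤ α) (hα1 : α ≤ 1)
    {h₁ h₂ : EuclideanSpace ℝ (Fin n) → EReal} (hcl₁ : IsClosed (epigraph h₁))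
    (hcl₂ : IsClosed (epigraph h₂)) (hconv₁ : Convex ℝ (epigraph h₁))
    (hconv₂ : Convex ℝ (epigraph h₂)) (hne₁ : (epigraph h₁).Nonempty)
    (hne₂ : (epigraph h₂).Nonempty)
    (hg₁ : ∀ M : ℝ, ∃ C : ℝ, ∀ z, ((M * ‖z‖ - C : ℝ) : EReal) ≤ h₁ z)
    (hg₂ : ∀ M : ℝ, ∃ C : ℝ, ∀ z, ((M * ‖z‖ - C : ℝ) : EReal) ≤ h₂ z) :
    epigraph (fconj fun y => (α : EReal) * fconj h₁ y + ((1 - α : ℝ) : EReal) * fconj h₂ y)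
      = epiCombo α h₁ h₂ := by
  have hβ0 : 0 ≤ 1 - α := by linarith
  choose m₁ hm₁ hle₁ happ₁ using exists_fconj_eq_coe hg₁ hne₁
  choose m₂ hm₂ hle₂ happ₂ using exists_fconj_eq_coe hg₂ hne₂
  have hval : ∀ x, fconj (fun y => (α : EReal) * fconj h₁ y + ((1 - α : ℝ) : EReal) * fconj h₂ y) x
      = ⨆ y, ((⟪y, x⟫ - (α * m₁ y + (1 - α) * m₂ y) : ℝ) : EReal) := by
    intro x
    refine iSup_congr fun y => ?_
    beta_reduce
    rw [hm₁, hm₂, ← EReal.coe_mul, ← EReal.coe_mul, ← EReal.coe_add, ← EReal.coe_sub,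
      real_inner_comm]
  ext ⟨x, r⟩
  simp only [epigraph, Set.mem_ofPred_eq]
  rw [hval]
  constructor
  · intro hx
    by_contra hn
    obtain ⟨C₁, hC₁⟩ := hg₁ 0
    obtain ⟨C₂, hC₂⟩ := hg₂ 0
    have hlow : ∀ p ∈ epiCombo α h₁ h₂, α * -C₁ + (1 - α) * -C₂ ≤ p.2 := by
      intro p hp
      obtain ⟨q₁, hq₁, q₂, hq₂, rfl⟩ := mem_epiCombo.1 hp
      have e₁ := EReal.coe_le_coe_iff.1 ((hC₁ q₁.1).trans hq₁)
      have e₂ := EReal.coe_le_coe_iff.1 ((hC₂ q₂.1).trans hq₂)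
      simp only [Prod.snd_add, Prod.smul_snd, smul_eq_mul]
      exact add_le_add (mul_le_mul_of_nonneg_left (by linarith) hα0)
        (mul_le_mul_of_nonneg_left (by linarith) hβ0)
    have hup : ∀ p ∈ epiCombo α h₁ h₂, ∀ t : ℝ, 0 ≤ t → (p.1, p.2 + t) ∈ epiCombo α h₁ h₂ := by
      intro p hp t ht
      obtain ⟨q₁, hq₁, q₂, hq₂, rfl⟩ := mem_epiCombo.1 hp
      refine mem_epiCombo.2 ⟨_, add_mem_epigraph hq₁ ht, _, add_mem_epigraph hq₂ ht, ?_⟩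
      ext1
      · simp
      · simp only [Prod.snd_add, Prod.smul_snd, smul_eq_mul]
        ring
    obtain ⟨y, c, hyK, hyx⟩ := exists_affine_minorant_of_notMem
      ((hconv₁.smul α).add (hconv₂.smul (1 - α)))
      (isClosed_epiCombo hα0 hα1 hcl₁ hcl₂ hne₁ hne₂ hg₁ hg₂)
      (hne₁.smul_set.add hne₂.smul_set) hup hlow hn
    have hmc : α * m₁ y + (1 - α) * m₂ y ≤ -c := by
      refine le_of_forall_pos_le_add fun ε hε => ?_
      obtain ⟨q₁, hq₁, hlt₁⟩ := happ₁ y ε hε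
      obtain ⟨q₂, hq₂, hlt₂⟩ := happ₂ y ε hε
      have := hyK _ (mem_epiCombo.2 ⟨q₁, hq₁, q₂, hq₂, rfl⟩)
      simp only [Prod.fst_add, Prod.smul_fst, Prod.snd_add, Prod.smul_snd, smul_eq_mul,
        inner_add_right, real_inner_smul_right] at this
      have a₁ := mul_le_mul_of_nonneg_left hlt₁.le hα0
      have a₂ := mul_le_mul_of_nonneg_left hlt₂.le hβ0
      linarith
    have := EReal.coe_le_coe_iff.1 ((le_iSup _ y).trans hx)
    linarith
  · intro hx
    obtain ⟨q₁, hq₁, q₂, hq₂, he⟩ := mem_epiCombo.1 hx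
    obtain ⟨rfl, rfl⟩ := Prod.mk.inj he
    refine iSup_le fun y => EReal.coe_le_coe_iff.2 ?_
    have a₁ := mul_le_mul_of_nonneg_left (hle₁ y q₁ hq₁) hα0
    have a₂ := mul_le_mul_of_nonneg_left (hle₂ y q₂ hq₂) hβ0
    simp only [Prod.smul_fst, Prod.smul_snd, smul_eq_mul, inner_add_right, real_inner_smul_right]
    linarith

/-- The Jensen gap of a Legendre function is jointly convex on its domain. -/
lemma convexOn_jensenGap_of_symm_bregman {n : ℕ}
    {φ : EuclideanSpace ℝ (Fin n) → EReal}
    {gφ : EuclideanSpace ℝ (Fin n) → EuclideanSpace ℝ (Fin n)}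
    (hφ : IsLegendre φ gφ)
    (hrc : ContinuousOn (fun x => (φ x).toReal) (edom φ))
    {Hess : EuclideanSpace ℝ (Fin n) → EuclideanSpace ℝ (Fin n) →L[ℝ] EuclideanSpace ℝ (Fin n)}
    (hHess : ∀ x ∈ interior (edom φ), HasFDerivAt gφ (Hess x) x)
    (hS : ConvexOn ℝ ((interior (edom φ)) ×ˢ (interior (edom φ)))
      (fun p : EuclideanSpace ℝ (Fin n) × EuclideanSpace ℝ (Fin n) =>
        ⟪gφ p.1 - gφ p.2, p.1 - p.2⟫))
    {α : ℝ} (hα0 : 0 ≤ α) (hα1 : α ≤ 1) :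
    ConvexOn ℝ (edom φ ×ˢ edom φ)
      (fun p : EuclideanSpace ℝ (Fin n) × EuclideanSpace ℝ (Fin n) =>
        α * (φ p.1).toReal + (1 - α) * (φ p.2).toReal
          - (φ (α • p.1 + (1 - α) • p.2)).toReal) := by
  have hβ0 : 0 ≤ 1 - α := by linarith
  have hdom := hφ.convex.convex_edom hφ.proper.1
  refine ConvexOn.of_interior (hdom.prod hdom) ?_ ?_ ?_
  · rw [interior_prod_eq]
    exact hφ.intNonempty.prod hφ.intNonempty
  · have c₁ := hrc.comp continuousOn_fst (fun p (hp : p ∈ edom φ ×ˢ edom φ) => hp.1)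
    have c₂ := hrc.comp continuousOn_snd (fun p (hp : p ∈ edom φ ×ˢ edom φ) => hp.2)
    have c₃ := hrc.comp (f := fun p : EuclideanSpace ℝ (Fin n) × EuclideanSpace ℝ (Fin n) =>
        α • p.1 + (1 - α) • p.2) (s := edom φ ×ˢ edom φ)
      (by fun_prop) (fun p hp => hdom hp.1 hp.2 hα0 hβ0 (by ring))
    exact ((c₁.const_mul α).add (c₂.const_mul (1 - α))).sub c₃
  · rw [interior_prod_eq]
    exact jensenGap_convexOn isOpen_interior hφ.grad hHess hS hα0 hβ0 (by ring)

/-- Sublevels of the Bregman proximal average, described by splitting the point along the two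
functions. -/
lemma pavg_le_coe_iff {n : ℕ} {φ f1 f2 : EuclideanSpace ℝ (Fin n) → EReal} {lam α : ℝ}
    (hlam : 0 < lam) (hφ : ∀ x, φ x ≠ ⊥) (hf1 : ∀ x, f1 x ≠ ⊥) (hf2 : ∀ x, f2 x ≠ ⊥)
    (hdom : Convex ℝ (edom φ)) (hα0 : 0 ≤ α) (hα1 : α ≤ 1)
    (hepi : epigraph (fconj fun y =>
        (α : EReal) * fconj (fun z => f1 z + ((1 / lam : ℝ) : EReal) * φ z) y
          + ((1 - α : ℝ) : EReal) * fconj (fun z => f2 z + ((1 / lam : ℝ) : EReal) * φ z) y)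
      = epiCombo α (fun z => f1 z + ((1 / lam : ℝ) : EReal) * φ z)
          (fun z => f2 z + ((1 / lam : ℝ) : EReal) * φ z))
    {x : EuclideanSpace ℝ (Fin n)} {r : ℝ} :
    pavg φ lam α f1 f2 x ≤ r ↔ ∃ q₁ ∈ epigraph f1, ∃ q₂ ∈ epigraph f2,
      q₁.1 ∈ edom φ ∧ q₂.1 ∈ edom φ ∧ x = α • q₁.1 + (1 - α) • q₂.1 ∧
      r = α * q₁.2 + (1 - α) * q₂.2 + 1 / lam * (α * (φ q₁.1).toReal
        + (1 - α) * (φ q₂.1).toReal - (φ (α • q₁.1 + (1 - α) • q₂.1)).toReal) := by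
  have hμ : 0 < 1 / lam := by positivity
  have hβ0 : 0 ≤ 1 - α := by linarith
  set F := fconj fun y =>
    (α : EReal) * fconj (fun z => f1 z + ((1 / lam : ℝ) : EReal) * φ z) y
      + ((1 - α : ℝ) : EReal) * fconj (fun z => f2 z + ((1 / lam : ℝ) : EReal) * φ z) y
  have decode : ∀ s : ℝ, F x ≤ s ↔ ∃ q₁ ∈ epigraph f1, ∃ q₂ ∈ epigraph f2,
      q₁.1 ∈ edom φ ∧ q₂.1 ∈ edom φ ∧ x = α • q₁.1 + (1 - α) • q₂.1 ∧
      s = α * (q₁.2 + 1 / lam * (φ q₁.1).toReal)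
        + (1 - α) * (q₂.2 + 1 / lam * (φ q₂.1).toReal) := by
    intro s
    change (x, s) ∈ epigraph F ↔ _
    rw [hepi, mem_epiCombo]
    constructor
    · rintro ⟨⟨x₁, s₁⟩, h₁, ⟨x₂, s₂⟩, h₂, he⟩
      obtain ⟨rfl, rfl⟩ := Prod.mk.inj he
      obtain ⟨p₁, hp₁, h₁⟩ := (EReal.add_coe_mul_le_coe_iff hμ (hf1 _) (hφ _)).1 h₁
      obtain ⟨p₂, hp₂, h₂⟩ := (EReal.add_coe_mul_le_coe_iff hμ (hf2 _) (hφ _)).1 h₂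
      refine ⟨(x₁, s₁ - 1 / lam * p₁), h₁, (x₂, s₂ - 1 / lam * p₂), h₂, ?_, ?_, rfl, ?_⟩
      · exact hp₁.trans_ne (EReal.coe_ne_top _)
      · exact hp₂.trans_ne (EReal.coe_ne_top _)
      · simp only at hp₁ hp₂
        simp [hp₁, hp₂]
    · rintro ⟨⟨x₁, s₁⟩, h₁, ⟨x₂, s₂⟩, h₂, d₁, d₂, hx, hs⟩
      refine ⟨(x₁, s₁ + 1 / lam * (φ x₁).toReal), ?_, (x₂, s₂ + 1 / lam * (φ x₂).toReal), ?_, ?_⟩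
      · exact (EReal.add_coe_mul_le_coe_iff hμ (hf1 _) (hφ _)).2
          ⟨_, (EReal.coe_toReal d₁ (hφ _)).symm, by simpa [epigraph] using h₁⟩
      · exact (EReal.add_coe_mul_le_coe_iff hμ (hf2 _) (hφ _)).2
          ⟨_, (EReal.coe_toReal d₂ (hφ _)).symm, by simpa [epigraph] using h₂⟩
      · exact (Prod.ext hx hs).symm
  have hxdom : F x ≠ ⊤ → x ∈ edom φ := by
    intro h
    obtain ⟨s, hs⟩ : ∃ s : ℝ, F x ≤ s := by
      obtain ⟨s, hs, -⟩ := EReal.lt_iff_exists_real_btwn.1 (lt_top_iff_ne_top.2 h)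
      exact ⟨s, hs.le⟩
    obtain ⟨q₁, -, q₂, -, d₁, d₂, hx, -⟩ := (decode s).1 hs
    rw [hx]
    exact hdom d₁ d₂ hα0 hβ0 (by ring)
  have hle : pavg φ lam α f1 f2 x ≤ r ↔
      x ∈ edom φ ∧ F x ≤ ((r + 1 / lam * (φ x).toReal : ℝ) : EReal) := by
    change esub (F x) (((1 / lam : ℝ) : EReal) * φ x) ≤ r ↔ _
    by_cases h : F x = ⊤
    · rw [h]
      simp [esub, -EReal.coe_add, -EReal.coe_mul]
    · have hx := hxdom h
      have hxr := EReal.coe_toReal hx (hφ x)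
      rw [esub, if_neg h, ← hxr, ← EReal.coe_mul, EReal.sub_le_iff_le_add (by simp) (by simp),
        ← EReal.coe_add, EReal.toReal_coe]
      simp [hx]
  rw [hle, decode]
  constructor
  · rintro ⟨-, q₁, h₁, q₂, h₂, d₁, d₂, hx, hs⟩
    refine ⟨q₁, h₁, q₂, h₂, d₁, d₂, hx, ?_⟩
    rw [← hx]
    linear_combination hs
  · rintro ⟨q₁, h₁, q₂, h₂, d₁, d₂, hx, hs⟩
    refine ⟨hx ▸ hdom d₁ d₂ hα0 hβ0 (by ring), q₁, h₁, q₂, h₂, d₁, d₂, hx, ?_⟩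
    rw [← hx] at hs
    linear_combination hs

theorem pavg_convex_of_symm_bregman_convex {n : ℕ}
    (φ : EuclideanSpace ℝ (Fin n) → EReal)
    (gφ : EuclideanSpace ℝ (Fin n) → EuclideanSpace ℝ (Fin n))
    (hφ : IsLegendre φ gφ) (hφco : SuperCoercive φ)
    (hcl : IsClosed (edom φ))
    (hrc : ContinuousOn (fun x => (φ x).toReal) (edom φ))
    (hC2 : ContDiffOn ℝ 2 (fun x => (φ x).toReal) (interior (edom φ)))
    (Hess : EuclideanSpace ℝ (Fin n) → EuclideanSpace ℝ (Fin n) →L[ℝ] EuclideanSpace ℝ (Fin n))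
    (hHess : ∀ x ∈ interior (edom φ), HasFDerivAt gφ (Hess x) x)
    (hHpos : ∀ x ∈ interior (edom φ), ∀ v : EuclideanSpace ℝ (Fin n), v ≠ 0 → 0 < ⟪v, Hess x v⟫)
    (hS : ConvexOn ℝ ((interior (edom φ)) ×ˢ (interior (edom φ)))
      (fun p : EuclideanSpace ℝ (Fin n) × EuclideanSpace ℝ (Fin n) => ⟪gφ p.1 - gφ p.2, p.1 - p.2⟫))
    (f1 f2 : EuclideanSpace ℝ (Fin n) → EReal) (hf1 : Gamma0 f1) (hf2 : Gamma0 f2)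
    (hri1 : (intrinsicInterior ℝ (edom f1) ∩ interior (edom φ)).Nonempty)
    (hri2 : (intrinsicInterior ℝ (edom f2) ∩ interior (edom φ)).Nonempty)
    (lam : ℝ) (hlam : 0 < lam)
    (α : ℝ) (hα0 : 0 ≤ α) (hα1 : α ≤ 1) :
    ConvexFn (pavg φ lam α f1 f2) := by
  have hμ : 0 < 1 / lam := by positivity
  have hβ0 : 0 ≤ 1 - α := by linarith
  have hφ0 : Gamma0 φ := ⟨hφ.proper, hφ.lsc, hφ.convex⟩
  have hdom := hφ.convex.convex_edom hφ.proper.1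
  have hcl' : ∀ {f : EuclideanSpace ℝ (Fin n) → EReal}, Gamma0 f →
      IsClosed (epigraph fun z => f z + ((1 / lam : ℝ) : EReal) * φ z) := fun hf =>
    (hf.2.1.add_coe_mul hφ.lsc hf.1.1 hφ.proper.1 hμ).isClosed_real_epigraph
  have hconv : ∀ {f : EuclideanSpace ℝ (Fin n) → EReal}, Gamma0 f →
      Convex ℝ (epigraph fun z => f z + ((1 / lam : ℝ) : EReal) * φ z) := fun hf =>
    convex_epigraph_add_coe_mul hf.2.2 hφ.convex hf.1.1 hφ.proper.1 hμ
  have hne : ∀ {f : EuclideanSpace ℝ (Fin n) → EReal}, Gamma0 f →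
      (intrinsicInterior ℝ (edom f) ∩ interior (edom φ)).Nonempty →
      (epigraph fun z => f z + ((1 / lam : ℝ) : EReal) * φ z).Nonempty := by
    rintro f hf ⟨x, hxf, hxφ⟩
    have h₁ := EReal.coe_toReal (intrinsicInterior_subset hxf) (hf.1.1 x)
    have h₂ := EReal.coe_toReal (interior_subset hxφ) (hφ.proper.1 x)
    refine ⟨(x, (f x).toReal + 1 / lam * (φ x).toReal),
      (EReal.add_coe_mul_le_coe_iff hμ (hf.1.1 x) (hφ.proper.1 x)).2 ⟨_, h₂.symm, ?_⟩⟩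
    rw [add_sub_cancel_right, h₁]
  have hg₁ := hf1.exists_norm_sub_le_add hφ0 hφco hμ
  have hg₂ := hf2.exists_norm_sub_le_add hφ0 hφco hμ
  have hiff := fun x r => pavg_le_coe_iff (x := x) (r := r) hlam hφ.proper.1 hf1.1.1 hf2.1.1 hdom
    hα0 hα1 (epigraph_fconj_combo hα0 hα1 (hcl' hf1) (hcl' hf2) (hconv hf1) (hconv hf2)
      (hne hf1 hri1) (hne hf2 hri2) hg₁ hg₂)
  have hJ := convexOn_jensenGap_of_symm_bregman hφ hrc hHess hS hα0 hα1
  refine convexFn_of_convex_epigraph (fun x hx => ?_) ?_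
  · obtain ⟨C₁, hC₁⟩ := hg₁ 0
    obtain ⟨C₂, hC₂⟩ := hg₂ 0
    have low : ∀ {f : EuclideanSpace ℝ (Fin n) → EReal} {C : ℝ},
        (∀ z, ((0 * ‖z‖ - C : ℝ) : EReal) ≤ f z + ((1 / lam : ℝ) : EReal) * φ z) →
        ∀ q ∈ epigraph f, q.1 ∈ edom φ → -C ≤ q.2 + 1 / lam * (φ q.1).toReal := by
      intro f C hC q hq hd
      have h := (hC q.1).trans (add_le_add_left hq _)
      rw [← EReal.coe_toReal hd (hφ.proper.1 q.1), ← EReal.coe_mul, ← EReal.coe_add,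
        EReal.coe_le_coe_iff] at h
      linarith
    obtain ⟨q₁, h₁, q₂, h₂, d₁, d₂, hxq, hr⟩ := (hiff x
      (α * -C₁ + (1 - α) * -C₂ - 1 / lam * (φ x).toReal - 1)).1 (hx ▸ bot_le)
    rw [← hxq] at hr
    have l₁ := mul_le_mul_of_nonneg_left (low hC₁ q₁ h₁ d₁) hα0
    have l₂ := mul_le_mul_of_nonneg_left (low hC₂ q₂ h₂ d₂) hβ0
    linarith
  · rintro ⟨x, r⟩ hx ⟨y, s⟩ hy a b ha hb hab
    obtain ⟨p₁, hp₁, p₂, hp₂, dp₁, dp₂, rfl, rfl⟩ := (hiff x r).1 hx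
    obtain ⟨q₁, hq₁, q₂, hq₂, dq₁, dq₂, rfl, rfl⟩ := (hiff y s).1 hy
    have h := hJ.2 (Set.mk_mem_prod dp₁ dp₂) (Set.mk_mem_prod dq₁ dq₂) ha hb hab
    refine le_trans ((hiff _ _).2 ⟨a • p₁ + b • q₁, hf1.2.2.convex_epigraph hp₁ hq₁ ha hb hab,
      a • p₂ + b • q₂, hf2.2.2.convex_epigraph hp₂ hq₂ ha hb hab, hdom dp₁ dq₁ ha hb hab,
      hdom dp₂ dq₂ ha hb hab, ?_, rfl⟩) (EReal.coe_le_coe_iff.2 ?_)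
    · simp only [Prod.smul_mk, Prod.mk_add_mk, Prod.fst_add, Prod.smul_fst]
      module
    · have h' := mul_le_mul_of_nonneg_left h hμ.le
      simp only [Prod.smul_mk, Prod.mk_add_mk, Prod.fst_add, Prod.smul_fst, Prod.snd_add,
        Prod.smul_snd, smul_eq_mul] at h' ⊢
      linarith

end
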